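/- Let Δ and Δ̄ be positive integers. Then there exists an integral (Δ,Δ̄)-nice coordination y minimizing LWH(y) among all (Δ,Δ̄)-nice coordinations; that is, the minimum of LWH over (Δ,Δ̄)-nice coordinations is attained at an integral coordination. -/

import Mathlib

open scoped Classical

noncomputable section

/-- An ordered storyline instance over a finite character type `C`. -/
structure Storyline (C : Type) [Fintype C] [DecidableEq C] where
  /-- the number `ℓ` of time steps; time steps are `1, …, len` -/
  len : ℕ
  len_pos : 0 < len
  /-- the set `A(c)` of time steps on which character `c` is active -/
  active : C → Finset ℕ
  active_nonempty : ∀ c, (active c).Nonempty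
  active_subset : ∀ c, active c ⊆ Finset.Icc 1 len
  /-- active time steps of a character are consecutive -/
  active_consec : ∀ c s t u, s ∈ active c → u ∈ active c → s ≤ t → t ≤ u → t ∈ active c
  /-- meetings, each given by its time step together with its set of characters -/
  meetings : Finset (ℕ × Finset C)
  meet_time : ∀ m ∈ meetings, m.1 ∈ Finset.Icc 1 len
  meet_active : ∀ m ∈ meetings, ∀ c ∈ m.2, m.1 ∈ active c
  /-- `pos t c` is the position of character `c` in the linear order `π_t` -/
  pos : ℕ → C → ℕ
  pos_injOn : ∀ t : ℕ, Set.InjOn (pos t) {c | t ∈ active c}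
  pos_lt : ∀ t c, t ∈ active c → pos t c < (Finset.univ.filter fun c' => t ∈ active c').card
  /-- the characters of each meeting appear consecutively in the order of its time step -/
  meet_consec : ∀ m ∈ meetings, ∀ c c'', c ∈ m.2 → c'' ∈ m.2 →
    ∀ c', m.1 ∈ active c' → pos m.1 c ≤ pos m.1 c' → pos m.1 c' ≤ pos m.1 c'' → c' ∈ m.2

namespace Storyline

variable {C : Type} [Fintype C] [DecidableEq C] (S : Storyline C)

/-- The set `T = {1, …, ℓ}` of time steps. -/
def T : Finset ℕ := Finset.Icc 1 S.len

/-- `Ac(t)`, the set of characters active at time step `t`. -/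
def Ac (t : ℕ) : Finset C := Finset.univ.filter fun c => t ∈ S.active c

/-- `c` and `c'` belong to a common meeting at time step `t`. -/
def SameMeeting (t : ℕ) (c c' : C) : Prop :=
  ∃ m ∈ S.meetings, m.1 = t ∧ c ∈ m.2 ∧ c' ∈ m.2

/-- `c` and `c'` are consecutive in `π_t` with `c ≺_t c'`. -/
def Consecutive (t : ℕ) (c c' : C) : Prop :=
  t ∈ S.active c ∧ t ∈ S.active c' ∧ S.pos t c' = S.pos t c + 1

/-- A coordination (`y t c` for `t ∈ A(c)`; other values are irrelevant) is valid if it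
respects all the orders `π_t`. -/
def Valid (y : ℕ → C → ℝ) : Prop :=
  ∀ t c c', t ∈ S.active c → t ∈ S.active c' → S.pos t c < S.pos t c' → y t c < y t c'

/-- A `(Δ, Δ̄)`-nice coordination. -/
def Nice (Δ Δbar : ℝ) (y : ℕ → C → ℝ) : Prop :=
  S.Valid y ∧
  ∀ t c c', S.Consecutive t c c' →
    (S.SameMeeting t c c' → |y t c' - y t c| = Δ) ∧
    (¬ S.SameMeeting t c c' → Δbar ≤ |y t c' - y t c|)

/-- A coordination is integral if all its (relevant) values are integers. -/
def Integral (y : ℕ → C → ℝ) : Prop :=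
  ∀ t c, t ∈ S.active c → ∃ z : ℤ, y t c = (z : ℝ)

/-- The total wiggle count `WC(y)`. -/
def WC (y : ℕ → C → ℝ) : ℕ :=
  Set.ncard {p : ℕ × C | 1 ≤ p.1 ∧ p.1 + 1 ≤ S.len ∧ p.1 ∈ S.active p.2 ∧
    p.1 + 1 ∈ S.active p.2 ∧ y p.1 p.2 ≠ y (p.1 + 1) p.2}

/-- The total linear wiggle height `LWH(y)`. -/
def LWH (y : ℕ → C → ℝ) : ℝ :=
  ∑ t ∈ Finset.Icc 1 (S.len - 1), ∑ c ∈ S.Ac t ∩ S.Ac (t + 1), |y t c - y (t + 1) c|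

/-- The total quadratic wiggle height `QWH(y)`. -/
def QWH (y : ℕ → C → ℝ) : ℝ :=
  ∑ t ∈ Finset.Icc 1 (S.len - 1), ∑ c ∈ S.Ac t ∩ S.Ac (t + 1), (y t c - y (t + 1) c) ^ 2

/-- Character `c` is wiggle-free in coordination `y`. -/
def WiggleFree (y : ℕ → C → ℝ) (c : C) : Prop :=
  ∀ t, t ∈ S.active c → t + 1 ∈ S.active c → y t c = y (t + 1) c

/-- Membership in the wiggle-height polytope (variables `y t c` for `t ∈ A(c)` and
`w t c` for `1 ≤ t ≤ ℓ - 1`, `c ∈ Ac(t) ∩ Ac(t+1)`; other values irrelevant). -/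
def InPolytope (Δ Δbar : ℝ) (y w : ℕ → C → ℝ) : Prop :=
  (∀ t c c', S.Consecutive t c c' → S.SameMeeting t c c' → y t c' - y t c = Δ) ∧
  (∀ t c c', S.Consecutive t c c' → ¬ S.SameMeeting t c c' → Δbar ≤ y t c' - y t c) ∧
  (∀ t c, 1 ≤ t → t + 1 ≤ S.len → t ∈ S.active c → t + 1 ∈ S.active c →
    y t c - y (t + 1) c ≤ w t c ∧ y (t + 1) c - y t c ≤ w t c) ∧
  (∀ t c, t ∈ S.active c → 0 ≤ y t c)

/-- `gap_t(c, c') = pos_t(c') - pos_t(c)` (as a real number). -/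
def gap (t : ℕ) (c c' : C) : ℝ := (S.pos t c' : ℝ) - (S.pos t c : ℝ)

/-- `Ccons_t(c, c')`: the number of positions `k` with `pos_t(c) ≤ k < pos_t(c')` such that
the characters at positions `k` and `k + 1` of `π_t` belong to a common meeting at `t`. -/
def Ccons (t : ℕ) (c c' : C) : ℕ :=
  Set.ncard {k : ℕ | S.pos t c ≤ k ∧ k < S.pos t c' ∧
    ∃ d d', t ∈ S.active d ∧ t ∈ S.active d' ∧ S.pos t d = k ∧ S.pos t d' = k + 1 ∧
      S.SameMeeting t d d'}

/-- `miny_t(c, c')`. -/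
def miny (Δ Δbar : ℝ) (t : ℕ) (c c' : C) : ℝ :=
  (S.Ccons t c c' : ℝ) * Δ + (S.gap t c c' - (S.Ccons t c c' : ℝ)) * Δbar

/-- `maxy_t(c, c')` (with value `+∞` when `c` and `c'` share no meeting at `t`). -/
def maxy (Δ : ℝ) (t : ℕ) (c c' : C) : EReal :=
  if S.SameMeeting t c c' then ((Δ * S.gap t c c' : ℝ) : EReal) else ⊤

end Storyline

namespace Storyline

/-- Shifting by `θ` and rounding down changes a distance, on average over `θ ∈ (0, 1]`,
by nothing. -/
lemma integral_abs_floor_sub (a b : ℝ) :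
    IntervalIntegrable (fun θ : ℝ => |((⌊a + θ⌋ : ℤ) : ℝ) - ((⌊b + θ⌋ : ℤ) : ℝ)|)
      MeasureTheory.volume 0 1 ∧
    ∫ θ in (0 : ℝ)..1, |((⌊a + θ⌋ : ℤ) : ℝ) - ((⌊b + θ⌋ : ℤ) : ℝ)| = |a - b| := by
  have floor_mono (a : ℝ) : Monotone fun θ : ℝ => ((⌊a + θ⌋ : ℤ) : ℝ) := fun x y h =>
    Int.cast_le.2 (Int.floor_mono (by linarith))
  have floor_int (a : ℝ) : IntervalIntegrable (fun θ : ℝ => ((⌊a + θ⌋ : ℤ) : ℝ))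
      MeasureTheory.volume 0 1 := (floor_mono a).intervalIntegrable
  have fract_int (a b : ℝ) :
      IntervalIntegrable (fun x : ℝ => Int.fract x) MeasureTheory.volume a b := by
    have h : Monotone fun x : ℝ => ((⌊x⌋ : ℤ) : ℝ) := fun x y h =>
      Int.cast_le.2 (Int.floor_mono h)
    exact (intervalIntegral.intervalIntegrable_id).sub h.intervalIntegrable
  have integral_floor (a : ℝ) : ∫ θ in (0 : ℝ)..1, ((⌊a + θ⌋ : ℤ) : ℝ) =
      a + 1 / 2 - ∫ x in (0 : ℝ)..1, Int.fract x := by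
    have hper : Function.Periodic (Int.fract : ℝ → ℝ) 1 := fun x => Int.fract_add_one x
    have h₁ := hper.intervalIntegral_add_eq a 0
    rw [intervalIntegral.integral_comp_add_left (fun x : ℝ => ((⌊x⌋ : ℤ) : ℝ)) a]
    have h₂ : (fun x : ℝ => ((⌊x⌋ : ℤ) : ℝ)) = fun x => x - Int.fract x := by
      funext x; rw [Int.self_sub_fract]
    rw [h₂, intervalIntegral.integral_sub intervalIntegral.intervalIntegrable_id (fract_int _ _),
      integral_id, add_zero, h₁, zero_add]
    ring
  refine ⟨((floor_int a).sub (floor_int b)).abs, ?_⟩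
  wlog hab : b ≤ a generalizing a b
  · simpa only [abs_sub_comm] using this b a (le_of_not_ge hab)
  have h (θ : ℝ) : |((⌊a + θ⌋ : ℤ) : ℝ) - ((⌊b + θ⌋ : ℤ) : ℝ)| =
      ((⌊a + θ⌋ : ℤ) : ℝ) - ((⌊b + θ⌋ : ℤ) : ℝ) :=
    abs_of_nonneg (sub_nonneg.2 (Int.cast_le.2 (Int.floor_mono (by linarith))))
  simp only [h]
  rw [intervalIntegral.integral_sub (floor_int a) (floor_int b), integral_floor, integral_floor,
    abs_of_nonneg (sub_nonneg.2 hab)]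
  ring

variable {C : Type} [Fintype C] [DecidableEq C] (S : Storyline C)

/-- Some shifted rounding of `y` does not increase the linear wiggle height. -/
lemma exists_floor_lwh_le (y : ℕ → C → ℝ) :
    ∃ θ : ℝ, S.LWH (fun t c => ((⌊y t c + θ⌋ : ℤ) : ℝ)) ≤ S.LWH y := by
  have hintegr : IntervalIntegrable (fun θ : ℝ => S.LWH fun t c => ((⌊y t c + θ⌋ : ℤ) : ℝ))
      MeasureTheory.volume 0 1 := by
    unfold LWH
    have h := IntervalIntegrable.sum (μ := MeasureTheory.volume) (a := 0) (b := 1)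
      (Finset.Icc 1 (S.len - 1)) fun t _ => IntervalIntegrable.sum (S.Ac t ∩ S.Ac (t + 1))
        fun c _ => (integral_abs_floor_sub (y t c) (y (t + 1) c)).1
    refine h.congr ?_
    intro θ _
    simp only [Finset.sum_apply]
  have heq : ∫ θ in (0 : ℝ)..1, S.LWH (fun t c => ((⌊y t c + θ⌋ : ℤ) : ℝ)) = S.LWH y := by
    unfold LWH
    rw [intervalIntegral.integral_finsetSum]
    · refine Finset.sum_congr rfl fun t _ => ?_
      rw [intervalIntegral.integral_finsetSum fun c _ => (integral_abs_floor_sub _ _).1]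
      exact Finset.sum_congr rfl fun c _ => (integral_abs_floor_sub _ _).2
    · intro t _
      refine (IntervalIntegrable.sum (S.Ac t ∩ S.Ac (t + 1))
        fun c _ => (integral_abs_floor_sub (y t c) (y (t + 1) c)).1).congr ?_
      intro θ _
      simp only [Finset.sum_apply]
  by_contra! hlt
  have h := intervalIntegral.intervalIntegral_pos_of_pos
    (hintegr.sub (intervalIntegrable_const (c := S.LWH y)))
    (fun θ => sub_pos.2 (hlt θ)) zero_lt_one
  rw [intervalIntegral.integral_sub hintegr intervalIntegrable_const, heq] at h
  simp at h

/-- Every position below `|Ac(t)|` is taken in `π_t`. -/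
lemma exists_pos_eq {t k : ℕ} (hk : k < (S.Ac t).card) :
    ∃ c, t ∈ S.active c ∧ S.pos t c = k := by
  have himg : (S.Ac t).image (S.pos t) = Finset.range (S.Ac t).card := by
    refine Finset.eq_of_subset_of_card_le ?_ ?_
    · intro k hk
      obtain ⟨c, hc, rfl⟩ := Finset.mem_image.1 hk
      exact Finset.mem_range.2 (S.pos_lt t c (Finset.mem_filter.1 hc).2)
    · rw [Finset.card_range, Finset.card_image_of_injOn]
      exact (S.pos_injOn t).mono fun c hc => (Finset.mem_filter.1 hc).2
  obtain ⟨c, hc, rfl⟩ := Finset.mem_image.1 (himg ▸ Finset.mem_range.2 hk)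
  exact ⟨c, (Finset.mem_filter.1 hc).2, rfl⟩

lemma Consecutive.exists_of_pos_lt {t : ℕ} {c c' : C} (hc : t ∈ S.active c)
    (hc' : t ∈ S.active c') (h : S.pos t c < S.pos t c') :
    ∃ d, S.Consecutive t c d ∧ S.pos t d ≤ S.pos t c' := by
  obtain ⟨d, hd, hpos⟩ := S.exists_pos_eq (lt_of_le_of_lt h (S.pos_lt t c' hc'))
  exact ⟨d, ⟨hc, hd, hpos⟩, hpos ▸ h⟩

/-- Rounding preserves niceness for positive integer distances. -/
lemma Nice.floor {Δ Δbar : ℕ} (hΔ : 0 < Δ) (hΔbar : 0 < Δbar) {y : ℕ → C → ℝ}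
    (hy : S.Nice Δ Δbar y) (θ : ℝ) :
    S.Nice Δ Δbar (fun t c => ((⌊y t c + θ⌋ : ℤ) : ℝ)) := by
  obtain ⟨hval, hcons⟩ := hy
  have hvalid_lt {t : ℕ} {c d : C} (h : S.Consecutive t c d) : y t c < y t d :=
    hval t c d h.1 h.2.1 (by have := h.2.2; omega)
  have hgap {t : ℕ} {c d : C} (h : S.Consecutive t c d) : y t c + 1 ≤ y t d := by
    have habs := abs_of_pos (sub_pos.2 (hvalid_lt h))
    have h₁ : (1 : ℝ) ≤ Δ := by exact_mod_cast hΔ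
    have h₂ : (1 : ℝ) ≤ Δbar := by exact_mod_cast hΔbar
    by_cases hm : S.SameMeeting t c d
    · have := (hcons t c d h).1 hm
      linarith
    · have := (hcons t c d h).2 hm
      linarith
  refine ⟨fun t c c' hc hc' hlt => ?_, fun t c c' h => ⟨fun hm => ?_, fun hm => ?_⟩⟩
  · obtain ⟨d, hd, hle⟩ := Consecutive.exists_of_pos_lt S hc hc' hlt
    have hdc : y t d ≤ y t c' := by
      rcases hle.eq_or_lt with heq | hlt
      · rw [S.pos_injOn t hd.2.1 hc' heq]
      · exact (hval t d c' hd.2.1 hc' hlt).le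
    have hle : ⌊y t c + θ⌋ + 1 ≤ ⌊y t c' + θ⌋ := by
      rw [← Int.floor_add_one]
      exact Int.floor_mono (by linarith [hgap hd])
    exact Int.cast_lt.2 (by omega)
  · have heq := (hcons t c c' h).1 hm
    rw [abs_of_pos (sub_pos.2 (hvalid_lt h))] at heq
    have hshift : y t c' + θ = y t c + θ + (Δ : ℕ) := by linarith
    simp only [hshift, Int.floor_add_natCast]
    push_cast
    simp
  · have hle := (hcons t c c' h).2 hm
    rw [abs_of_pos (sub_pos.2 (hvalid_lt h))] at hle
    have hfl : ⌊y t c + θ⌋ + (Δbar : ℤ) ≤ ⌊y t c' + θ⌋ := by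
      rw [← Int.floor_add_natCast]
      exact Int.floor_mono (by linarith)
    refine le_trans ?_ (le_abs_self _)
    have : ((⌊y t c + θ⌋ : ℤ) : ℝ) + (Δbar : ℝ) ≤ ((⌊y t c' + θ⌋ : ℤ) : ℝ) := by
      exact_mod_cast hfl
    linarith

lemma exists_nice {Δ Δbar : ℕ} (hΔ : 0 < Δ) (hΔbar : 0 < Δbar) :
    ∃ y, S.Nice (Δ : ℝ) (Δbar : ℝ) y := by
  let step (t k : ℕ) : ℕ := if ∃ c c', S.Consecutive t c c' ∧ S.pos t c = k ∧
    S.SameMeeting t c c' then Δ else Δbar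
  have hstep (t k : ℕ) : 0 < step t k := by
    dsimp only [step]
    split_ifs <;> assumption
  have hmono (t : ℕ) : StrictMono fun n => ∑ k ∈ Finset.range n, step t k :=
    strictMono_nat_of_lt_succ fun n => by
      rw [Finset.sum_range_succ]
      exact Nat.lt_add_of_pos_right (hstep t n)
  have hdiff {t : ℕ} {c c' : C} (h : S.Consecutive t c c') :
      |((∑ k ∈ Finset.range (S.pos t c'), step t k : ℕ) : ℝ) -
        ((∑ k ∈ Finset.range (S.pos t c), step t k : ℕ) : ℝ)| = (step t (S.pos t c) : ℝ) := by
    rw [h.2.2, Finset.sum_range_succ, Nat.cast_add, add_sub_cancel_left, Nat.abs_cast]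
  refine ⟨fun t c => ((∑ k ∈ Finset.range (S.pos t c), step t k : ℕ) : ℝ),
    fun t c c' _ _ h => Nat.cast_lt.2 (hmono t h), fun t c c' h => ⟨fun hm => ?_, fun hm => ?_⟩⟩
  · rw [hdiff h, Nat.cast_inj]
    exact if_pos ⟨c, c', h, rfl, hm⟩
  · rw [hdiff h, Nat.cast_le]
    refine (if_neg ?_).ge
    rintro ⟨d, d', hd, hpos, hm'⟩
    obtain rfl := S.pos_injOn t hd.1 h.1 hpos
    obtain rfl := S.pos_injOn t hd.2.1 h.2.1 (by rw [hd.2.2, h.2.2])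
    exact hm hm'

lemma Integral.exists_lwh_eq_natCast {y : ℕ → C → ℝ} (hy : S.Integral y) :
    ∃ n : ℕ, S.LWH y = n := by
  choose! z hz using hy
  refine ⟨∑ t ∈ Finset.Icc 1 (S.len - 1), ∑ c ∈ S.Ac t ∩ S.Ac (t + 1),
    (z t c - z (t + 1) c).natAbs, ?_⟩
  unfold LWH
  push_cast
  refine Finset.sum_congr rfl fun t _ => Finset.sum_congr rfl fun c hc => ?_
  obtain ⟨h₁, h₂⟩ := Finset.mem_inter.1 hc
  rw [hz t c (Finset.mem_filter.1 h₁).2, hz (t + 1) c (Finset.mem_filter.1 h₂).2,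
    Nat.cast_natAbs]
  push_cast
  rfl

/-- For positive integers `Δ, Δ̄`, the minimum of `LWH` over `(Δ, Δ̄)`-nice coordinations is
attained at an integral coordination. -/
theorem exists_integral_lwh_min {C : Type} [Fintype C] [DecidableEq C] (S : Storyline C)
    (Δ Δbar : ℕ) (hΔ : 0 < Δ) (hΔbar : 0 < Δbar) :
    ∃ y, S.Nice (Δ : ℝ) (Δbar : ℝ) y ∧ S.Integral y ∧
      ∀ y', S.Nice (Δ : ℝ) (Δbar : ℝ) y' → S.LWH y ≤ S.LWH y' := by
  have hround (y : ℕ → C → ℝ) (hy : S.Nice (Δ : ℝ) (Δbar : ℝ) y) :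
      ∃ n : ℕ, (∃ z, S.Nice (Δ : ℝ) (Δbar : ℝ) z ∧ S.Integral z ∧ S.LWH z = n) ∧
        (n : ℝ) ≤ S.LWH y := by
    obtain ⟨θ, hθ⟩ := S.exists_floor_lwh_le y
    have hintegr : S.Integral fun t c => ((⌊y t c + θ⌋ : ℤ) : ℝ) := fun t c _ => ⟨_, rfl⟩
    obtain ⟨n, hn⟩ := Integral.exists_lwh_eq_natCast S hintegr
    exact ⟨n, ⟨_, Nice.floor S hΔ hΔbar hy θ, hintegr, hn⟩, hn ▸ hθ⟩
  obtain ⟨y₀, hy₀⟩ := S.exists_nice hΔ hΔbar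
  obtain ⟨n₀, hn₀, -⟩ := hround y₀ hy₀
  have hex : ∃ n : ℕ, ∃ z, S.Nice (Δ : ℝ) (Δbar : ℝ) z ∧ S.Integral z ∧ S.LWH z = n := ⟨n₀, hn₀⟩
  obtain ⟨y, hnice, hintegr, heq⟩ := Nat.find_spec hex
  refine ⟨y, hnice, hintegr, fun y' hy' => ?_⟩
  obtain ⟨n, hn, hle⟩ := hround y' hy'
  rw [heq]
  exact le_trans (Nat.cast_le.2 (Nat.find_min' hex hn)) hle

end Storyline
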